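/- arXiv:2301.10155 — 3 statements merged into one kernel-verified Lean document; each statement's English description precedes it below -/
import Mathlib

section
/- Let λ > 0, and for t ∈ ℝ define M_λ(t) = t − 2λ·⌊t/(2λ) + 1/2⌋ and mod(t, 2λ) = t − 2λ·⌊t/(2λ)⌋. Then for all x, z ∈ ℝ, M_λ(x + z) ≤ M_λ(x) + mod(z, 2λ). (Inequality (n_3) in the proof of Theorem 4.) -/
/-- The centered modulo operator `M_λ(t) = t − 2λ·⌊t/(2λ) + 1/2⌋`. -/
noncomputable def centeredMod (lam t : ℝ) : ℝ :=
  t - 2 * lam * (⌊t / (2 * lam) + 1 / 2⌋ : ℝ)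

/-- The ordinary modulo operator `mod(t, 2λ) = t − 2λ·⌊t/(2λ)⌋`. -/
noncomputable def ordinaryMod (lam t : ℝ) : ℝ :=
  t - 2 * lam * (⌊t / (2 * lam)⌋ : ℝ)

/-- Inequality (n_3): `M_λ(x + z) ≤ M_λ(x) + mod(z, 2λ)`. -/
theorem centeredMod_add_le (lam : ℝ) (hlam : 0 < lam) (x z : ℝ) :
    centeredMod lam (x + z) ≤ centeredMod lam x + ordinaryMod lam z := by
  have h : ⌊x / (2 * lam) + 1 / 2⌋ + ⌊z / (2 * lam)⌋ ≤ ⌊(x + z) / (2 * lam) + 1 / 2⌋ := by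
    have e : (x + z) / (2 * lam) + 1 / 2 = (x / (2 * lam) + 1 / 2) + z / (2 * lam) := by ring
    rw [e]
    exact Int.le_floor_add _ _
  have h' : ((⌊x / (2 * lam) + 1 / 2⌋ : ℝ) + (⌊z / (2 * lam)⌋ : ℝ))
      ≤ (⌊(x + z) / (2 * lam) + 1 / 2⌋ : ℝ) := by exact_mod_cast h
  have h2 := mul_le_mul_of_nonneg_left h' (by positivity : (0 : ℝ) ≤ 2 * lam)
  unfold centeredMod ordinaryMod
  linarith
end

section
/- Let λ > 0, and for t ∈ ℝ define M_λ(t) = t − 2λ·⌊t/(2λ) + 1/2⌋ and mod(t, 2λ) = t − 2λ·⌊t/(2λ)⌋. Then for all x, z ∈ ℝ there exists q ∈ {0, 1} such that M_λ(x + z) = M_λ(x) + mod(z, 2λ) − 2(1 − q)λ. Consequently, for vectors, if ỹ = M_λ(x + z) entrywise and x̃ = M_λ(x) entrywise, then ỹ = x̃ + z̃ where z̃_k = mod(z_k, 2λ) − 2(1 − q_k)λ with q_k ∈ {0, 1}. (Theorem 4: additive noise on the input signal carries over as additive noise on the modulo samples.) -/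
/-- Theorem 4: additive noise on the input signal carries over as additive
noise on the modulo samples.  Scalar version: for all `x, z` there is
`q ∈ {0,1}` with `M_λ(x + z) = M_λ(x) + mod(z, 2λ) − 2(1 − q)λ`; vector
version: `ỹ = x̃ + z̃` entrywise with `z̃_k = mod(z_k, 2λ) − 2(1 − q_k)λ`,
`q_k ∈ {0,1}`. -/
theorem centeredMod_additive_noise (lam : ℝ) (hlam : 0 < lam) :
    (∀ x z : ℝ, ∃ q : ℝ, (q = 0 ∨ q = 1) ∧
        centeredMod lam (x + z)
          = centeredMod lam x + ordinaryMod lam z - 2 * (1 - q) * lam) ∧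
    ∀ (n : ℕ) (x z : Fin n → ℝ), ∃ q : Fin n → ℝ,
        (∀ k, q k = 0 ∨ q k = 1) ∧
        ∀ k, centeredMod lam (x k + z k)
          = centeredMod lam (x k)
            + (ordinaryMod lam (z k) - 2 * (1 - q k) * lam) := by
  have key : ∀ x z : ℝ, ∃ q : ℝ, (q = 0 ∨ q = 1) ∧
        centeredMod lam (x + z)
          = centeredMod lam x + ordinaryMod lam z - 2 * (1 - q) * lam := by
    intro x z
    have h1 := Int.le_floor_add (x / (2 * lam) + 1 / 2) (z / (2 * lam))
    have h2 := Int.le_floor_add_floor (x / (2 * lam) + 1 / 2) (z / (2 * lam))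
    have e : (x + z) / (2 * lam) + 1 / 2 = x / (2 * lam) + 1 / 2 + z / (2 * lam) := by ring
    unfold centeredMod ordinaryMod
    rw [e]
    generalize ⌊x / (2 * lam) + 1 / 2 + z / (2 * lam)⌋ = N at *
    generalize ⌊x / (2 * lam) + 1 / 2⌋ = A at *
    generalize ⌊z / (2 * lam)⌋ = B at *
    have h : N = A + B ∨ N = A + B + 1 := by omega
    rcases h with rfl | rfl
    · exact ⟨1, Or.inr rfl, by push_cast; ring⟩
    · exact ⟨0, Or.inl rfl, by push_cast; ring⟩
  refine ⟨key, fun n x z => ?_⟩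
  choose q hq using fun k => key (x k) (z k)
  exact ⟨q, fun k => (hq k).1, fun k => by rw [(hq k).2]; ring⟩
end

section
/- Let n, m be positive integers, let x ∈ ℝⁿ and let τ^(1),…,τ^(m) ∈ ℝⁿ, and define the one-bit samples r^(ℓ)_j = sgn(x_j − τ^(ℓ)_j) for all j, ℓ, where sgn(u) = 1 for u > 0, sgn(u) = −1 for u < 0, and sgn(0) = 0. Suppose that for some index k, x_k > 0, x_k = ‖x‖_∞, and ‖τ^(ℓ)‖_∞ < x_k for every ℓ. Then for every t ≥ 0 the vector y = x + t·e_k (where e_k is the k-th standard basis vector) satisfies all the one-bit polyhedron inequalities: r^(ℓ)_j · (y_j − τ^(ℓ)_j) ≥ 0 for all j ∈ {1,…,n} and ℓ ∈ {1,…,m}. In particular the feasible set of the one-bit polyhedron contains an unbounded ray and the desired signal cannot be confined to a finite-volume region. (Section IV-D: failure of guaranteed one-bit reconstruction when DR_x > DR_τ.) -/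
/-- Section IV-D (failure of guaranteed one-bit reconstruction when
`DR_x > DR_τ`): with one-bit samples `r^(ℓ)_j = sgn(x_j − τ^(ℓ)_j)`, if
`x_k > 0`, `x_k = ‖x‖_∞` and `‖τ^(ℓ)‖_∞ < x_k` for each `ℓ`, then for every
`t ≥ 0` the point `y = x + t·e_k` satisfies all the one-bit polyhedron
inequalities `r^(ℓ)_j · (y_j − τ^(ℓ)_j) ≥ 0`; hence the feasible set contains
an unbounded ray.  Here `‖·‖` on `Fin n → ℝ` is the sup (ℓ∞) norm. -/
theorem one_bit_polyhedron_unbounded_ray (n m : ℕ) (hn : 0 < n) (hm : 0 < m)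
    (x : Fin n → ℝ) (τ : Fin m → Fin n → ℝ) (k : Fin n)
    (hxk_pos : 0 < x k) (hxk_max : x k = ‖x‖)
    (hτ : ∀ ℓ : Fin m, ‖τ ℓ‖ < x k) :
    ∀ t : ℝ, 0 ≤ t →
      ∀ (ℓ : Fin m) (j : Fin n),
        Real.sign (x j - τ ℓ j)
            * ((x j + t * (if j = k then 1 else 0)) - τ ℓ j) ≥ 0 := by
  intro t ht ℓ j
  by_cases hj : j = k
  · subst hj
    have h1 : τ ℓ j < x j :=
      lt_of_le_of_lt ((le_abs_self _).trans (norm_le_pi_norm (τ ℓ) j)) (hτ ℓ)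
    rw [Real.sign_of_pos (by linarith)]
    simp only [if_true]
    linarith
  · simp only [if_neg hj, mul_zero, add_zero]
    rcases lt_trichotomy (x j - τ ℓ j) 0 with h | h | h
    · rw [Real.sign_of_neg h]; linarith
    · rw [h]; simp
    · rw [Real.sign_of_pos h]; linarith
end
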